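/- Let μ be a positive odd integer and ν ∈ ℝ. For each i ∈ {3,4} and each integer j ≥ −μ, the function Λ_{i,j}^{μ,ν} satisfies the fourth-order differential equation D_{μ,ν}Λ_{i,j}^{μ,ν}(x) = 4j(j+μ+1)·Λ_{i,j}^{μ,ν}(x) for all x > 0. -/

import Mathlib

noncomputable section

open Set MeasureTheory Filter Topology

/-- The Euler operator `θ = x·d/dx` acting on real-valued functions on `ℝ`. -/
def eulerOp (u : ℝ → ℝ) : ℝ → ℝ := fun x => x * deriv u x

/-- The operator `(θ + a)(θ + b) − x²` applied to `v`. -/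
def quadOp (a b : ℝ) (v : ℝ → ℝ) : ℝ → ℝ := fun x =>
  eulerOp (fun y => eulerOp v y + b * v y) x
    + a * (eulerOp v x + b * v x) - x ^ 2 * v x

/-- The fourth-order operator `D_{μ,ν} = x⁻²((θ+μ+ν)(θ+μ) − x²)(θ(θ+ν) − x²)`. -/
def Dop (μ ν : ℝ) (u : ℝ → ℝ) : ℝ → ℝ := fun x =>
  quadOp (μ + ν) μ (quadOp 0 ν u) x / x ^ 2

/-- The normalized I-Bessel function `Ĩ_α(z) = Σ (z/2)^{2n}/(n!·Γ(n+α+1))`. -/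
def tildeI (α z : ℝ) : ℝ :=
  ∑' n : ℕ, (z / 2) ^ (2 * n) / ((n.factorial : ℝ) * Real.Gamma ((n : ℝ) + α + 1))

/-- The K-Bessel function `K_α(z) = ∫₀^∞ e^{−z·cosh s}·cosh(α·s) ds`. -/
def besselK (α z : ℝ) : ℝ :=
  ∫ s in Ioi (0 : ℝ), Real.exp (-z * Real.cosh s) * Real.cosh (α * s)

/-- The normalized K-Bessel function `K̃_α(z) = (z/2)^{−α}·K_α(z)`. -/
def tildeK (α z : ℝ) : ℝ := (z / 2) ^ (-α) * besselK α z

/-- The generating function `G₁^{μ,ν}(t,x)`. -/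
def genG₁ (μ ν t x : ℝ) : ℝ :=
  (1 - t) ^ (-(μ + ν + 2) / 2) * tildeI (μ / 2) (t * x / (1 - t)) * tildeI (ν / 2) (x / (1 - t))

/-- The generating function `G₂^{μ,ν}(t,x)`. -/
def genG₂ (μ ν t x : ℝ) : ℝ :=
  (1 - t) ^ (-(μ + ν + 2) / 2) * tildeI (μ / 2) (t * x / (1 - t)) * tildeK (ν / 2) (x / (1 - t))

/-- The generating function `G₃^{μ,ν}(t,x)`. -/
def genG₃ (μ ν t x : ℝ) : ℝ :=
  (1 - t) ^ (-(μ + ν + 2) / 2) * tildeK (μ / 2) (t * x / (1 - t)) * tildeI (ν / 2) (x / (1 - t))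

/-- The generating function `G₄^{μ,ν}(t,x)`. -/
def genG₄ (μ ν t x : ℝ) : ℝ :=
  (1 - t) ^ (-(μ + ν + 2) / 2) * tildeK (μ / 2) (t * x / (1 - t)) * tildeK (ν / 2) (x / (1 - t))

/-- `Λ₁ⱼ^{μ,ν}(x) = (1/j!)·(∂/∂t)^j|₀ G₁^{μ,ν}(t,x)`. -/
def Lambda₁ (μ ν : ℝ) (j : ℕ) (x : ℝ) : ℝ :=
  iteratedDeriv j (fun t => genG₁ μ ν t x) 0 / (j.factorial : ℝ)

/-- `Λ₂ⱼ^{μ,ν}(x) = (1/j!)·(∂/∂t)^j|₀ G₂^{μ,ν}(t,x)`. -/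
def Lambda₂ (μ ν : ℝ) (j : ℕ) (x : ℝ) : ℝ :=
  iteratedDeriv j (fun t => genG₂ μ ν t x) 0 / (j.factorial : ℝ)

/-- `Λ₁ⱼ` for integer `j`, vanishing for `j < 0`. -/
def Lambda₁Z (μ ν : ℝ) (j : ℤ) (x : ℝ) : ℝ :=
  if 0 ≤ j then Lambda₁ μ ν j.toNat x else 0

/-- `Λ₂ⱼ` for integer `j`, vanishing for `j < 0`. -/
def Lambda₂Z (μ ν : ℝ) (j : ℤ) (x : ℝ) : ℝ :=
  if 0 ≤ j then Lambda₂ μ ν j.toNat x else 0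

/-- For `μ = m` a positive odd integer, `Λ₃ⱼ^{μ,ν}(x) = (1/(j+μ)!)·(∂/∂t)^{j+μ}|₀ [tᵐ·G₃]`,
the derivative at `0` being the limit from the right of the `(j+μ)`-th derivative of the
real-analytic function `t ↦ tᵐ·G₃^{m,ν}(t,x)` on `(0,1)`; it vanishes for `j < −μ`. -/
def Lambda₃ (m : ℕ) (ν : ℝ) (j : ℤ) (x : ℝ) : ℝ :=
  if -(m : ℤ) ≤ j then
    limUnder (𝓝[>] (0 : ℝ))
        (fun t => iteratedDeriv (j + (m : ℤ)).toNat (fun s => s ^ m * genG₃ (m : ℝ) ν s x) t) /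
      (((j + (m : ℤ)).toNat.factorial : ℝ))
  else 0

/-- For `μ = m` a positive odd integer, `Λ₄ⱼ^{μ,ν}(x) = (1/(j+μ)!)·(∂/∂t)^{j+μ}|₀ [tᵐ·G₄]`,
vanishing for `j < −μ`. -/
def Lambda₄ (m : ℕ) (ν : ℝ) (j : ℤ) (x : ℝ) : ℝ :=
  if -(m : ℤ) ≤ j then
    limUnder (𝓝[>] (0 : ℝ))
        (fun t => iteratedDeriv (j + (m : ℤ)).toNat (fun s => s ^ m * genG₄ (m : ℝ) ν s x) t) /
      (((j + (m : ℤ)).toNat.factorial : ℝ))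
  else 0

open scoped ContDiff

/-- The entire function `w ↦ Σ wⁿ/(n!·Γ(n+α+1))`, so that `Ĩ_α(z) = besselEntire α ((z/2)²)`. -/
def besselEntire (α w : ℝ) : ℝ :=
  ∑' n : ℕ, w ^ n / ((n.factorial : ℝ) * Real.Gamma ((n : ℝ) + α + 1))

theorem inv_Gamma_eq_mul_inv_Gamma_add_one (s : ℝ) :
    (Real.Gamma s)⁻¹ = s * (Real.Gamma (s + 1))⁻¹ := by
  rcases eq_or_ne s 0 with rfl | h
  · simp
  · rw [Real.Gamma_add_one h, mul_inv, mul_inv_cancel_left₀ h]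

theorem besselEntire_term_eq (α w : ℝ) (n : ℕ) :
    w * (w ^ n / ((n.factorial : ℝ) * Real.Gamma ((n : ℝ) + α + 1))) =
      ((n : ℝ) + 1) * ((n : ℝ) + α + 1) *
        (w ^ (n + 1) / (((n + 1).factorial : ℝ) * Real.Gamma (((n + 1 : ℕ) : ℝ) + α + 1))) := by
  have h := inv_Gamma_eq_mul_inv_Gamma_add_one ((n : ℝ) + α + 1)
  have e : ((n + 1 : ℕ) : ℝ) + α + 1 = (n : ℝ) + α + 1 + 1 := by push_cast; ring
  have hf : (n.factorial : ℝ) ≠ 0 := by positivity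
  have hn : (n : ℝ) + 1 ≠ 0 := by positivity
  rw [e, div_eq_mul_inv, mul_inv, h, Nat.factorial_succ, div_eq_mul_inv, mul_inv]
  push_cast
  field_simp
  ring

theorem summable_besselEntire (α w : ℝ) :
    Summable fun n : ℕ => w ^ n / ((n.factorial : ℝ) * Real.Gamma ((n : ℝ) + α + 1)) := by
  refine summable_of_ratio_norm_eventually_le (r := 1 / 2) (by norm_num) ?_
  filter_upwards [(tendsto_natCast_atTop_atTop (R := ℝ)).eventually_ge_atTop (2 * |w| + |α|)]
    with n hn
  set a := w ^ n / ((n.factorial : ℝ) * Real.Gamma ((n : ℝ) + α + 1))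
  set b := w ^ (n + 1) / (((n + 1).factorial : ℝ) * Real.Gamma (((n + 1 : ℕ) : ℝ) + α + 1))
  have h : w * a = ((n : ℝ) + 1) * ((n : ℝ) + α + 1) * b := besselEntire_term_eq α w n
  have hw := abs_nonneg w
  have hα := abs_nonneg α
  have h1 : 2 * |w| + 1 ≤ (n : ℝ) + 1 := by linarith
  have h2 : 1 ≤ (n : ℝ) + α + 1 := by linarith [neg_abs_le α]
  have h3 : |w| * |a| = ((n : ℝ) + 1) * ((n : ℝ) + α + 1) * |b| := by
    rw [← abs_mul, h, abs_mul, abs_of_pos (by nlinarith : 0 < ((n : ℝ) + 1) * ((n : ℝ) + α + 1))]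
  have h4 : (2 * |w| + 1) * |b| ≤ |w| * |a| := by
    rw [h3]
    gcongr
    nlinarith
  rw [Real.norm_eq_abs, Real.norm_eq_abs]
  rcases hw.eq_or_lt with h0 | h0
  · rw [← h0] at h4
    have := abs_nonneg a
    linarith
  · nlinarith [abs_nonneg b]

theorem besselEntire_deriv_term (α w : ℝ) (n : ℕ) :
    ((n + 1 : ℕ) : ℝ) * w ^ n /
        (((n + 1).factorial : ℝ) * Real.Gamma (((n + 1 : ℕ) : ℝ) + α + 1)) =
      w ^ n / ((n.factorial : ℝ) * Real.Gamma ((n : ℝ) + (α + 1) + 1)) := by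
  have e : ((n + 1 : ℕ) : ℝ) + α + 1 = (n : ℝ) + (α + 1) + 1 := by push_cast; ring
  have hn : ((n + 1 : ℕ) : ℝ) ≠ 0 := by positivity
  rw [e, Nat.factorial_succ, Nat.cast_mul, mul_assoc, mul_div_mul_left _ _ hn]

theorem hasDerivAt_besselEntire (α w : ℝ) :
    HasDerivAt (besselEntire α) (besselEntire (α + 1) w) w := by
  set R := |w| + 1
  have hR : 0 ≤ R := by positivity
  have hsum : ∀ y : ℝ, Summable fun n : ℕ => (n : ℝ) * y ^ (n - 1) /
      ((n.factorial : ℝ) * Real.Gamma ((n : ℝ) + α + 1)) := fun y => by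
    rw [← summable_nat_add_iff 1]
    exact (summable_besselEntire (α + 1) y).congr fun n => (besselEntire_deriv_term α y n).symm
  have key := hasDerivAt_tsum_of_isPreconnected (t := Metric.ball (0 : ℝ) R)
    (g := fun (n : ℕ) (y : ℝ) => y ^ n / ((n.factorial : ℝ) * Real.Gamma ((n : ℝ) + α + 1)))
    (g' := fun (n : ℕ) (y : ℝ) => (n : ℝ) * y ^ (n - 1) /
      ((n.factorial : ℝ) * Real.Gamma ((n : ℝ) + α + 1)))
    (y₀ := 0) (y := w) (hsum R).norm Metric.isOpen_ball
    (convex_ball (0 : ℝ) R).isPreconnected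
    (fun n y _ => (hasDerivAt_pow n y).div_const _) ?_ (Metric.mem_ball_self (by positivity))
    (summable_besselEntire α 0) (by simp [R])
  · refine key.congr_deriv ?_
    rw [(hsum w).tsum_eq_zero_add, besselEntire]
    simp only [Nat.add_sub_cancel, besselEntire_deriv_term]
    simp
  · intro n y hy
    have hy' : |y| ≤ R := by simpa using (Metric.mem_ball.1 hy).le
    rw [norm_div, norm_div, norm_mul (n : ℝ), norm_mul (n : ℝ), norm_pow, norm_pow,
      Real.norm_eq_abs y, Real.norm_of_nonneg hR]
    gcongr

theorem contDiff_besselEntire (α : ℝ) : ContDiff ℝ ∞ (besselEntire α) := by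
  rw [contDiff_infty]
  intro n
  induction n generalizing α with
  | zero =>
    exact contDiff_zero.2
      (continuous_iff_continuousAt.2 fun w => (hasDerivAt_besselEntire α w).continuousAt)
  | succ n ih =>
    rw [Nat.cast_succ, contDiff_succ_iff_deriv]
    refine ⟨fun w => (hasDerivAt_besselEntire α w).differentiableAt, by simp, ?_⟩
    rw [show deriv (besselEntire α) = besselEntire (α + 1) from
      funext fun w => (hasDerivAt_besselEntire α w).deriv]
    exact ih (α + 1)

theorem besselEntire_recurrence (α w : ℝ) :
    w * besselEntire (α + 2) w + (α + 1) * besselEntire (α + 1) w = besselEntire α w := by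
  have h0 := (summable_besselEntire α w).tsum_eq_zero_add
  have h1 := (summable_besselEntire (α + 1) w).tsum_eq_zero_add
  have s1 := (summable_nat_add_iff 1).2 (summable_besselEntire (α + 1) w)
  have s2 := summable_besselEntire (α + 2) w
  simp only [besselEntire]
  rw [h0, h1, mul_add, ← tsum_mul_left, ← tsum_mul_left, add_left_comm,
    ← (s2.mul_left w).tsum_add (s1.mul_left (α + 1))]
  have g0 := inv_Gamma_eq_mul_inv_Gamma_add_one (α + 1)
  congr 1
  · simpa [div_eq_mul_inv] using g0.symm
  · refine tsum_congr fun n => ?_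
    have g := inv_Gamma_eq_mul_inv_Gamma_add_one ((n : ℝ) + α + 2)
    have hf : (n.factorial : ℝ) ≠ 0 := by positivity
    have hn : (n : ℝ) + 1 ≠ 0 := by positivity
    have e1 : (n : ℝ) + (α + 2) + 1 = (n : ℝ) + α + 2 + 1 := by ring
    have e2 : ((n + 1 : ℕ) : ℝ) + (α + 1) + 1 = (n : ℝ) + α + 2 + 1 := by push_cast; ring
    have e3 : ((n + 1 : ℕ) : ℝ) + α + 1 = (n : ℝ) + α + 2 := by push_cast; ring
    rw [e1, e2, e3, div_eq_mul_inv, div_eq_mul_inv, div_eq_mul_inv, mul_inv, mul_inv, mul_inv, g,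
      Nat.factorial_succ]
    push_cast
    field_simp
    ring

/-- `f` is smooth on `s` and satisfies there `z·f'' + (1 + β)·f' = z·f`, the differential equation
`θ(θ + β)f = z²·f` of the normalized Bessel functions of order `β/2`. -/
structure IsBesselSolution (s : Set ℝ) (β : ℝ) (f : ℝ → ℝ) : Prop where
  contDiffOn : ContDiffOn ℝ ∞ f s
  ode : ∀ z ∈ s, z * deriv (deriv f) z + (1 + β) * deriv f z = z * f z

theorem tildeI_eq (α z : ℝ) : tildeI α z = besselEntire α ((z / 2) ^ 2) := by
  simp only [tildeI, besselEntire, pow_mul]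

theorem hasDerivAt_tildeI (α z : ℝ) : HasDerivAt (tildeI α) (z / 2 * tildeI (α + 1) z) z := by
  rw [show tildeI α = fun z => besselEntire α ((z / 2) ^ 2) from funext (tildeI_eq α), tildeI_eq]
  refine ((hasDerivAt_besselEntire α _).comp z
    (((hasDerivAt_id z).div_const 2).pow 2)).congr_deriv ?_
  simp
  ring

theorem isBesselSolution_tildeI (β : ℝ) (s : Set ℝ) :
    IsBesselSolution s β (tildeI (β / 2)) where
  contDiffOn := by
    rw [show tildeI (β / 2) = fun z => besselEntire (β / 2) ((z / 2) ^ 2) from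
      funext (tildeI_eq _)]
    exact ((contDiff_besselEntire _).comp (by fun_prop)).contDiffOn
  ode z _ := by
    have h1 : deriv (tildeI (β / 2)) = fun z => z / 2 * tildeI (β / 2 + 1) z :=
      funext fun z => (hasDerivAt_tildeI _ z).deriv
    have h2 : HasDerivAt (fun z => z / 2 * tildeI (β / 2 + 1) z)
        (1 / 2 * tildeI (β / 2 + 1) z + z / 2 * (z / 2 * tildeI (β / 2 + 1 + 1) z)) z :=
      ((hasDerivAt_id' z).div_const 2).mul (hasDerivAt_tildeI (β / 2 + 1) z)
    have h3 := besselEntire_recurrence (β / 2) ((z / 2) ^ 2)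
    simp only [← tildeI_eq] at h3
    rw [h1, h2.deriv, ← h3, show β / 2 + 1 + 1 = β / 2 + 2 by ring]
    ring

theorem one_add_sq_div_four_le_cosh (s : ℝ) (hs : 0 ≤ s) : 1 + s ^ 2 / 4 ≤ Real.cosh s := by
  have h1 := Real.quadratic_le_exp_of_nonneg hs
  have h2 := Real.add_one_le_exp (-s)
  rw [Real.cosh_eq]
  linarith

/-- A Gaussian bound, for `z > 0`, on the integrand of the K-Bessel function. -/
theorem exp_neg_mul_cosh_mul_exp_le {z : ℝ} (hz : 0 < z) (c : ℝ) {s : ℝ} (hs : 0 ≤ s) :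
    Real.exp (-z * Real.cosh s) * Real.exp (c * s) ≤
      Real.exp (2 * c ^ 2 / z) * Real.exp (-(z / 8) * s ^ 2) := by
  rw [← Real.exp_add, ← Real.exp_add]
  apply Real.exp_le_exp.2
  have h := mul_le_mul_of_nonneg_left (one_add_sq_div_four_le_cosh s hs) hz.le
  have h2 : 0 ≤ z / 8 * (s - 4 * c / z) ^ 2 := by positivity
  have h3 : z / 8 * (s - 4 * c / z) ^ 2 = z / 8 * s ^ 2 - c * s + 2 * c ^ 2 / z := by
    field_simp
    ring
  nlinarith

theorem cosh_le_exp_abs (y : ℝ) : Real.cosh y ≤ Real.exp |y| := by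
  rw [← Real.cosh_abs, Real.cosh_eq]
  have := Real.exp_le_exp.2 (neg_le_self (abs_nonneg y))
  linarith

theorem abs_sinh_le_cosh (y : ℝ) : |Real.sinh y| ≤ Real.cosh y := by
  rw [Real.abs_sinh, ← Real.cosh_abs]
  exact (Real.sinh_lt_cosh _).le

theorem exp_neg_mul_cosh_mul_cosh_le {z : ℝ} (hz : 0 < z) (α : ℝ) {s : ℝ} (hs : 0 ≤ s) :
    Real.exp (-z * Real.cosh s) * Real.cosh (α * s) ≤
      Real.exp (2 * α ^ 2 / z) * Real.exp (-(z / 8) * s ^ 2) := by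
  have h := exp_neg_mul_cosh_mul_exp_le hz |α| hs
  rw [sq_abs] at h
  refine le_trans ?_ h
  gcongr
  simpa [abs_mul, abs_of_nonneg hs] using cosh_le_exp_abs (α * s)

theorem integrableOn_besselK {z : ℝ} (hz : 0 < z) (α : ℝ) :
    IntegrableOn (fun s => Real.exp (-z * Real.cosh s) * Real.cosh (α * s)) (Ioi 0) := by
  refine Integrable.mono' (((integrable_exp_neg_mul_sq (by positivity : 0 < z / 8)).const_mul
    (Real.exp (2 * α ^ 2 / z))).integrableOn) ?_ ?_
  · exact Continuous.aestronglyMeasurable (by fun_prop)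
  · refine (ae_restrict_iff' measurableSet_Ioi).2 (Eventually.of_forall fun s hs => ?_)
    rw [Real.norm_of_nonneg (mul_nonneg (Real.exp_pos _).le (Real.cosh_pos _).le)]
    exact exp_neg_mul_cosh_mul_cosh_le hz α (le_of_lt hs)

theorem cosh_mul_cosh_eq (α s : ℝ) : Real.cosh s * Real.cosh (α * s) =
    (Real.cosh ((α + 1) * s) + Real.cosh ((α - 1) * s)) / 2 := by
  rw [add_mul, sub_mul, one_mul, Real.cosh_add, Real.cosh_sub]
  ring

theorem sinh_mul_sinh_eq (α s : ℝ) : Real.sinh s * Real.sinh (α * s) =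
    (Real.cosh ((α + 1) * s) - Real.cosh ((α - 1) * s)) / 2 := by
  rw [add_mul, sub_mul, one_mul, Real.cosh_add, Real.cosh_sub]
  ring

theorem hasDerivAt_besselK (α : ℝ) {z : ℝ} (hz : 0 < z) :
    HasDerivAt (besselK α) (-(besselK (α + 1) z + besselK (α - 1) z) / 2) z := by
  have hz2 : 0 < z / 2 := by positivity
  have hI := fun y (hy : 0 < y) => (integrableOn_besselK (z := y) hy (α + 1)).add
    (integrableOn_besselK hy (α - 1))
  have key := (hasDerivAt_integral_of_dominated_loc_of_deriv_le (μ := volume.restrict (Ioi 0))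
    (F := fun z s => Real.exp (-z * Real.cosh s) * Real.cosh (α * s))
    (F' := fun z s => -Real.cosh s * (Real.exp (-z * Real.cosh s) * Real.cosh (α * s)))
    (bound := fun s => (Real.exp (-(z / 2) * Real.cosh s) * Real.cosh ((α + 1) * s) +
      Real.exp (-(z / 2) * Real.cosh s) * Real.cosh ((α - 1) * s)) / 2)
    (Ioi_mem_nhds (by linarith : z / 2 < z)) (Eventually.of_forall fun y =>
      Continuous.aestronglyMeasurable (by fun_prop))
    (integrableOn_besselK hz α) (Continuous.aestronglyMeasurable (by fun_prop))
    (Eventually.of_forall fun s y hy => ?_) ((hI _ hz2).div_const 2)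
    (Eventually.of_forall fun s y hy => ?_)).2
  · refine key.congr_deriv ?_
    simp only [besselK]
    rw [← integral_add (integrableOn_besselK hz _) (integrableOn_besselK hz _), ← integral_neg,
      ← integral_div]
    refine integral_congr_ae (Eventually.of_forall fun s => ?_)
    have h := cosh_mul_cosh_eq α s
    simp only
    linear_combination -Real.exp (-z * Real.cosh s) * h
  · rw [norm_mul, norm_neg, Real.norm_of_nonneg (Real.cosh_pos s).le,
      Real.norm_of_nonneg (mul_nonneg (Real.exp_pos _).le (Real.cosh_pos _).le)]
    have h := cosh_mul_cosh_eq α s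
    have hc := (Real.cosh_pos s).le
    have hc' := (Real.cosh_pos (α * s)).le
    have he : Real.exp (-y * Real.cosh s) ≤ Real.exp (-(z / 2) * Real.cosh s) := by
      have : z / 2 < y := hy
      gcongr
    calc _ = Real.exp (-y * Real.cosh s) * (Real.cosh s * Real.cosh (α * s)) := by ring
      _ ≤ Real.exp (-(z / 2) * Real.cosh s) * (Real.cosh s * Real.cosh (α * s)) := by gcongr
      _ = _ := by rw [h]; ring
  · exact ((((hasDerivAt_id' y).fun_neg.mul_const (Real.cosh s)).exp).mul_const _).congr_deriv
      (by ring)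

theorem besselK_recurrence (α : ℝ) {z : ℝ} (hz : 0 < z) :
    z * (besselK (α + 1) z - besselK (α - 1) z) = 2 * α * besselK α z := by
  have hderiv : ∀ s ∈ Ici (0 : ℝ), HasDerivAt
      (fun s => Real.exp (-z * Real.cosh s) * Real.sinh (α * s))
      (α * (Real.exp (-z * Real.cosh s) * Real.cosh (α * s)) -
        z / 2 * (Real.exp (-z * Real.cosh s) * Real.cosh ((α + 1) * s) -
          Real.exp (-z * Real.cosh s) * Real.cosh ((α - 1) * s))) s := fun s _ => by
    have h := sinh_mul_sinh_eq α s
    refine ((((Real.hasDerivAt_cosh s).const_mul (-z)).exp).mul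
      (((hasDerivAt_id' s).const_mul α).sinh)).congr_deriv ?_
    linear_combination (-z * Real.exp (-z * Real.cosh s)) * h
  have hI : IntegrableOn (fun s => z / 2 * (Real.exp (-z * Real.cosh s) * Real.cosh ((α + 1) * s) -
      Real.exp (-z * Real.cosh s) * Real.cosh ((α - 1) * s))) (Ioi 0) :=
    ((integrableOn_besselK hz (α + 1)).sub (integrableOn_besselK hz (α - 1))).const_mul (z / 2)
  have hlim : Tendsto (fun s => Real.exp (-z * Real.cosh s) * Real.sinh (α * s)) atTop (𝓝 0) := by
    have hg : Tendsto (fun s : ℝ => Real.exp (2 * α ^ 2 / z) * Real.exp (-(z / 8) * s ^ 2)) atTop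
        (𝓝 0) := by
      rw [← mul_zero (Real.exp (2 * α ^ 2 / z))]
      refine (Real.tendsto_exp_atBot.comp ?_).const_mul _
      exact (tendsto_pow_atTop two_ne_zero).const_mul_atTop_of_neg (by linarith)
    refine squeeze_zero_norm' ?_ hg
    filter_upwards [eventually_ge_atTop 0] with s hs
    rw [norm_mul, Real.norm_of_nonneg (Real.exp_pos _).le, Real.norm_eq_abs]
    refine le_trans ?_ (exp_neg_mul_cosh_mul_cosh_le hz α hs)
    gcongr
    exact abs_sinh_le_cosh _
  have key := integral_Ioi_of_hasDerivAt_of_tendsto' hderiv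
    (((integrableOn_besselK hz α).const_mul α).sub hI) hlim
  rw [integral_sub ((integrableOn_besselK hz α).const_mul α) hI, integral_const_mul,
    integral_const_mul,
    integral_sub (integrableOn_besselK hz (α + 1)) (integrableOn_besselK hz (α - 1))] at key
  simp only [mul_zero, Real.sinh_zero, sub_zero] at key
  simp only [besselK]
  linear_combination -2 * key

theorem besselK_neg (α z : ℝ) : besselK (-α) z = besselK α z := by
  simp only [besselK, neg_mul, Real.cosh_neg]

theorem hasDerivAt_half_rpow_neg (α : ℝ) {z : ℝ} (hz : 0 < z) :
    HasDerivAt (fun z : ℝ => (z / 2) ^ (-α)) (-α / z * (z / 2) ^ (-α)) z := by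
  have h : z / 2 ≠ 0 := by positivity
  refine (((hasDerivAt_id' z).div_const 2).rpow_const (Or.inl h)).congr_deriv ?_
  rw [Real.rpow_sub_one h]
  field_simp

theorem half_rpow_neg_add_one (α : ℝ) {z : ℝ} (hz : 0 < z) :
    (z / 2) ^ (-α) = z / 2 * (z / 2) ^ (-(α + 1)) := by
  have h : z / 2 ≠ 0 := by positivity
  rw [neg_add, ← sub_eq_add_neg, Real.rpow_sub_one h, mul_div_cancel₀ _ h]

theorem hasDerivAt_tildeK (α : ℝ) {z : ℝ} (hz : 0 < z) :
    HasDerivAt (tildeK α) (-(z / 2) * tildeK (α + 1) z) z := by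
  refine ((hasDerivAt_half_rpow_neg α hz).fun_mul (hasDerivAt_besselK α hz)).congr_deriv ?_
  have h := besselK_recurrence α hz
  simp only [tildeK]
  rw [half_rpow_neg_add_one α hz]
  field_simp
  linear_combination h

theorem tildeK_recurrence (α : ℝ) {z : ℝ} (hz : 0 < z) :
    (z / 2) ^ 2 * tildeK (α + 2) z = (α + 1) * tildeK (α + 1) z + tildeK α z := by
  have h := besselK_recurrence (α + 1) hz
  rw [add_sub_cancel_right, add_assoc, one_add_one_eq_two] at h
  simp only [tildeK]
  rw [half_rpow_neg_add_one α hz, half_rpow_neg_add_one (α + 1) hz, add_assoc, one_add_one_eq_two]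
  linear_combination (z / 4 * (z / 2) ^ (-(α + 2))) * h

theorem contDiffOn_tildeK (α : ℝ) : ContDiffOn ℝ ∞ (tildeK α) (Ioi 0) := by
  rw [contDiffOn_infty]
  intro n
  induction n generalizing α with
  | zero =>
    exact contDiffOn_zero.2 fun z hz => (hasDerivAt_tildeK α hz).continuousAt.continuousWithinAt
  | succ n ih =>
    rw [Nat.cast_succ, contDiffOn_succ_iff_deriv_of_isOpen isOpen_Ioi]
    refine ⟨fun z hz => (hasDerivAt_tildeK α hz).differentiableAt.differentiableWithinAt,
      by simp, ?_⟩
    exact (ContDiffOn.mul (by fun_prop) (ih (α + 1))).congr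
      fun z hz => (hasDerivAt_tildeK α hz).deriv

theorem isBesselSolution_tildeK (β : ℝ) : IsBesselSolution (Ioi 0) β (tildeK (β / 2)) where
  contDiffOn := contDiffOn_tildeK _
  ode z hz := by
    have h1 : deriv (tildeK (β / 2)) =ᶠ[𝓝 z] fun z => -(z / 2) * tildeK (β / 2 + 1) z := by
      filter_upwards [Ioi_mem_nhds hz] with y hy using (hasDerivAt_tildeK _ hy).deriv
    have h2 : HasDerivAt (fun z => -(z / 2) * tildeK (β / 2 + 1) z)
        (-(1 / 2) * tildeK (β / 2 + 1) z +
          -(z / 2) * (-(z / 2) * tildeK (β / 2 + 1 + 1) z)) z :=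
      ((hasDerivAt_id' z).div_const 2).fun_neg.fun_mul (hasDerivAt_tildeK (β / 2 + 1) hz)
    have h3 := tildeK_recurrence (β / 2) hz
    rw [h1.deriv_eq, h2.deriv, h1.eq_of_nhds, add_assoc (β / 2), one_add_one_eq_two]
    linear_combination z * h3

theorem exists_tildeK_half_eq :
    ∃ C : ℝ, ∀ z : ℝ, 0 < z → z * tildeK (1 / 2) z = C * Real.exp (-z) := by
  have hd : ∀ z ∈ Ioi (0 : ℝ),
      HasDerivAt (fun z => Real.exp z * (z * tildeK (1 / 2) z)) 0 z := fun z hz => by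
    have h := hasDerivAt_tildeK (1 / 2) hz
    refine ((Real.hasDerivAt_exp z).fun_mul ((hasDerivAt_id' z).fun_mul h)).congr_deriv ?_
    have h0 : tildeK (-(1 / 2) + 1) z = tildeK (1 / 2) z := by norm_num
    have h1 : tildeK (-(1 / 2)) z = z / 2 * tildeK (1 / 2) z := by
      simp only [tildeK]
      rw [half_rpow_neg_add_one _ hz, besselK_neg, mul_assoc]
      norm_num
    have h2 := tildeK_recurrence (-(1 / 2)) hz
    rw [h0, h1, show -(1 / 2 : ℝ) + 2 = 1 / 2 + 1 by norm_num] at h2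
    linear_combination (-2 * Real.exp z) * h2
  refine ⟨Real.exp 1 * (1 * tildeK (1 / 2) 1), fun z hz => ?_⟩
  have h := isOpen_Ioi.is_const_of_deriv_eq_zero isPreconnected_Ioi
    (fun z hz => (hd z hz).differentiableAt.differentiableWithinAt)
    (fun z hz => (hd z hz).deriv) hz (mem_Ioi.2 one_pos)
  rw [← h, Real.exp_neg]
  field_simp

/-- For odd `m`, the function `zᵐ·K̃_{m/2}(z)` on `(0,∞)` extends to a smooth solution on `ℝ` of
the equation with parameter `-m`. -/
theorem exists_isBesselSolution_pow_mul_tildeK (k : ℕ) :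
    ∃ Q : ℝ → ℝ, IsBesselSolution univ (-((2 * k + 1 : ℕ) : ℝ)) Q ∧
      ∀ z : ℝ, 0 < z → z ^ (2 * k + 1) * tildeK (((2 * k + 1 : ℕ) : ℝ) / 2) z = Q z := by
  induction k with
  | zero =>
    obtain ⟨C, hC⟩ := exists_tildeK_half_eq
    have h1 : deriv (fun z => C * Real.exp (-z)) = fun z => -C * Real.exp (-z) := funext fun z =>
      ((((hasDerivAt_id' z).fun_neg.exp).const_mul C).congr_deriv (by ring)).deriv
    have h2 : deriv (fun z => -C * Real.exp (-z)) = fun z => C * Real.exp (-z) := funext fun z =>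
      ((((hasDerivAt_id' z).fun_neg.exp).const_mul (-C)).congr_deriv (by ring)).deriv
    refine ⟨fun z => C * Real.exp (-z), ⟨by fun_prop, fun z _ => ?_⟩, fun z hz => ?_⟩
    · rw [h1, h2]
      norm_num
    · simpa using hC z hz
  | succ k ih =>
    obtain ⟨Q, ⟨hs, hode⟩, hQ⟩ := ih
    set m : ℕ := 2 * k + 1 with hm
    have hs0 := contDiffOn_univ.1 hs
    have hs1 := (contDiff_infty_iff_deriv.1 hs0).2
    have hs2 := (contDiff_infty_iff_deriv.1 hs1).2
    have d0 := fun z => (hs0.differentiable (by simp) z).hasDerivAt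
    have d1 := fun z => (hs1.differentiable (by simp) z).hasDerivAt
    have hm' : ((2 * (k + 1) + 1 : ℕ) : ℝ) = m + 2 := by push_cast [hm]; ring
    have h1 : deriv (fun z => 2 * (m * Q z - z * deriv Q z)) = fun z => -2 * (z * Q z) :=
      funext fun z => by
        rw [((((d0 z).const_mul (m : ℝ)).fun_sub
          ((hasDerivAt_id' z).fun_mul (d1 z))).const_mul 2).deriv]
        have := hode z trivial
        linear_combination -2 * this
    have h2 : ∀ z, deriv (fun z => -2 * (z * Q z)) z = -2 * (Q z + z * deriv Q z) := fun z => by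
      rw [(((hasDerivAt_id' z).fun_mul (d0 z)).const_mul (-2)).deriv]
      ring
    refine ⟨fun z => 2 * (m * Q z - z * deriv Q z), ⟨by fun_prop, fun z _ => ?_⟩, fun z hz => ?_⟩
    · rw [h1, h2, hm']
      ring
    · have hQ' : Q =ᶠ[𝓝 z] fun z => z ^ m * tildeK (m / 2) z := by
        filter_upwards [Ioi_mem_nhds hz] with y hy using (hQ y hy).symm
      have h3 := ((hasDerivAt_pow m z).fun_mul (hasDerivAt_tildeK (m / 2) hz)).deriv
      have h4 : z * z ^ (m - 1) = z ^ m := by rw [← pow_succ']; congr 1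
      have hq := hQ'.deriv_eq
      rw [h3] at hq
      simp only
      rw [hq, ← hQ z hz, hm', show ((m : ℝ) + 2) / 2 = m / 2 + 1 by ring,
        show 2 * (k + 1) + 1 = m + 2 by omega]
      linear_combination (2 * m * tildeK (m / 2) z) * h4

/-- Smoothness, jointly in both variables, of a function `F t x` for `t ∈ U` and `x ∈ V`. -/
def SmoothOn₂ (U V : Set ℝ) (F : ℝ → ℝ → ℝ) : Prop :=
  ContDiffOn ℝ ∞ (Function.uncurry F) (U ×ˢ V)

section Parametric

variable {U V : Set ℝ} {F : ℝ → ℝ → ℝ} {t x : ℝ}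

theorem SmoothOn₂.contDiffAt (h : SmoothOn₂ U V F) (hU : IsOpen U) (hV : IsOpen V) (ht : t ∈ U)
    (hx : x ∈ V) : ContDiffAt ℝ ∞ (Function.uncurry F) (t, x) :=
  ContDiffOn.contDiffAt h ((hU.prod hV).mem_nhds ⟨ht, hx⟩)

theorem SmoothOn₂.contDiffOn_left (h : SmoothOn₂ U V F) (hx : x ∈ V) :
    ContDiffOn ℝ ∞ (fun s => F s x) U :=
  ContDiffOn.comp (g := Function.uncurry F) h (f := fun s => (s, x)) (by fun_prop)
    fun _ hs => ⟨hs, hx⟩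

theorem SmoothOn₂.hasDerivAt_left (h : SmoothOn₂ U V F) (hU : IsOpen U) (hV : IsOpen V)
    (ht : t ∈ U) (hx : x ∈ V) :
    HasDerivAt (fun s => F s x) (fderiv ℝ (Function.uncurry F) (t, x) (1, 0)) t :=
  ((h.contDiffAt hU hV ht hx).differentiableAt (by simp)).hasFDerivAt.comp_hasDerivAt
    (f := fun s => (s, x)) t ((hasDerivAt_id' t).prodMk (hasDerivAt_const t x))

theorem SmoothOn₂.hasDerivAt_right (h : SmoothOn₂ U V F) (hU : IsOpen U) (hV : IsOpen V)
    (ht : t ∈ U) (hx : x ∈ V) :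
    HasDerivAt (F t) (fderiv ℝ (Function.uncurry F) (t, x) (0, 1)) x :=
  ((h.contDiffAt hU hV ht hx).differentiableAt (by simp)).hasFDerivAt.comp_hasDerivAt
    (f := fun y => (t, y)) x ((hasDerivAt_const x t).prodMk (hasDerivAt_id' x))

theorem SmoothOn₂.fderiv_apply (h : SmoothOn₂ U V F) (hU : IsOpen U) (hV : IsOpen V) (v : ℝ × ℝ) :
    SmoothOn₂ U V fun t x => fderiv ℝ (Function.uncurry F) (t, x) v :=
  (ContDiffOn.fderiv_of_isOpen h (hU.prod hV) (m := ∞) (by simp)).clm_apply contDiffOn_const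

theorem SmoothOn₂.deriv_left (h : SmoothOn₂ U V F) (hU : IsOpen U) (hV : IsOpen V) :
    SmoothOn₂ U V fun t x => deriv (fun s => F s x) t :=
  ContDiffOn.congr (h.fderiv_apply hU hV (1, 0)) fun _ hp =>
    (h.hasDerivAt_left hU hV hp.1 hp.2).deriv

theorem SmoothOn₂.deriv_right (h : SmoothOn₂ U V F) (hU : IsOpen U) (hV : IsOpen V) :
    SmoothOn₂ U V fun t x => deriv (F t) x :=
  ContDiffOn.congr (h.fderiv_apply hU hV (0, 1)) fun _ hp =>
    (h.hasDerivAt_right hU hV hp.1 hp.2).deriv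

theorem SmoothOn₂.deriv_comm (h : SmoothOn₂ U V F) (hU : IsOpen U) (hV : IsOpen V) (ht : t ∈ U)
    (hx : x ∈ V) :
    deriv (fun y => deriv (fun s => F s y) t) x = deriv (fun s => deriv (F s) x) t := by
  have hc := h.contDiffAt hU hV ht hx
  have hd : DifferentiableAt ℝ (fderiv ℝ (Function.uncurry F)) (t, x) :=
    (hc.fderiv_right (m := ∞) (by simp)).differentiableAt (by simp)
  have e1 : (fun y => deriv (fun s => F s y) t) =ᶠ[𝓝 x]
      fun y => fderiv ℝ (Function.uncurry F) (t, y) (1, 0) := by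
    filter_upwards [hV.mem_nhds hx] with y hy using (h.hasDerivAt_left hU hV ht hy).deriv
  have e2 : (fun s => deriv (F s) x) =ᶠ[𝓝 t]
      fun s => fderiv ℝ (Function.uncurry F) (s, x) (0, 1) := by
    filter_upwards [hU.mem_nhds ht] with s hs using (h.hasDerivAt_right hU hV hs hx).deriv
  have d1 := (hd.hasFDerivAt.comp_hasDerivAt (f := fun y => (t, y)) x
    ((hasDerivAt_const x t).prodMk (hasDerivAt_id' x))).clm_apply
      (hasDerivAt_const x ((1 : ℝ), (0 : ℝ)))
  have d2 := (hd.hasFDerivAt.comp_hasDerivAt (f := fun s => (s, x)) t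
    ((hasDerivAt_id' t).prodMk (hasDerivAt_const t x))).clm_apply
      (hasDerivAt_const t ((0 : ℝ), (1 : ℝ)))
  rw [e1.deriv_eq, e2.deriv_eq]
  refine d1.deriv.trans (Eq.trans ?_ d2.deriv.symm)
  simpa using hc.isSymmSndFDerivAt (by simpa using ENat.LEInfty.out) (0, 1) (1, 0)

theorem SmoothOn₂.deriv_iteratedDeriv (h : SmoothOn₂ U V F) (hU : IsOpen U) (hV : IsOpen V)
    (ht : t ∈ U) (hx : x ∈ V) (k : ℕ) :
    deriv (fun y => iteratedDeriv k (fun s => F s y) t) x =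
      iteratedDeriv k (fun s => deriv (F s) x) t := by
  induction k generalizing F with
  | zero => simp
  | succ k ih =>
    simp only [iteratedDeriv_succ']
    rw [ih (h.deriv_left hU hV)]
    refine Filter.EventuallyEq.iteratedDeriv_eq k ?_
    filter_upwards [hU.mem_nhds ht] with s hs using h.deriv_comm hU hV hs hx

theorem SmoothOn₂.mul {G : ℝ → ℝ → ℝ} (hF : SmoothOn₂ U V F) (hG : SmoothOn₂ U V G) :
    SmoothOn₂ U V fun t x => F t x * G t x :=
  ContDiffOn.mul hF hG

theorem SmoothOn₂.add {G : ℝ → ℝ → ℝ} (hF : SmoothOn₂ U V F) (hG : SmoothOn₂ U V G) :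
    SmoothOn₂ U V fun t x => F t x + G t x :=
  ContDiffOn.add hF hG

theorem SmoothOn₂.sub {G : ℝ → ℝ → ℝ} (hF : SmoothOn₂ U V F) (hG : SmoothOn₂ U V G) :
    SmoothOn₂ U V fun t x => F t x - G t x :=
  ContDiffOn.sub hF hG

theorem smoothOn₂_right {f : ℝ → ℝ} (hf : ContDiff ℝ ∞ f) : SmoothOn₂ U V fun _ x => f x :=
  (hf.comp contDiff_snd).contDiffOn

theorem smoothOn₂_left {f : ℝ → ℝ} (hf : ContDiff ℝ ∞ f) : SmoothOn₂ U V fun t _ => f t :=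
  (hf.comp contDiff_fst).contDiffOn

theorem SmoothOn₂.const_mul (hF : SmoothOn₂ U V F) (c : ℝ) : SmoothOn₂ U V fun t x => c * F t x :=
  (smoothOn₂_right contDiff_const).mul hF

theorem SmoothOn₂.eulerOp (hF : SmoothOn₂ U V F) (hU : IsOpen U) (hV : IsOpen V) :
    SmoothOn₂ U V fun t => eulerOp (F t) :=
  (smoothOn₂_right contDiff_id).mul (hF.deriv_right hU hV)

theorem SmoothOn₂.eulerOp_add_mul (hF : SmoothOn₂ U V F) (hU : IsOpen U) (hV : IsOpen V) (b : ℝ) :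
    SmoothOn₂ U V fun t x => _root_.eulerOp (F t) x + b * F t x :=
  (hF.eulerOp hU hV).add (hF.const_mul b)

theorem SmoothOn₂.quadOp (hF : SmoothOn₂ U V F) (hU : IsOpen U) (hV : IsOpen V) (a b : ℝ) :
    SmoothOn₂ U V fun t => quadOp a b (F t) :=
  (((hF.eulerOp_add_mul hU hV b).eulerOp hU hV).add
    ((hF.eulerOp_add_mul hU hV b).const_mul a)).sub
    ((smoothOn₂_right (f := fun x => x ^ 2) (by fun_prop)).mul hF)

theorem eulerOp_congr {v w : ℝ → ℝ} (hV : IsOpen V) (h : EqOn v w V) :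
    EqOn (eulerOp v) (eulerOp w) V := fun x hx => by
  simp only [eulerOp, (h.eventuallyEq_of_mem (hV.mem_nhds hx)).deriv_eq]

theorem quadOp_congr {v w : ℝ → ℝ} (hV : IsOpen V) (h : EqOn v w V) (a b : ℝ) :
    EqOn (quadOp a b v) (quadOp a b w) V := fun x hx => by
  have h1 : EqOn (fun y => eulerOp v y + b * v y) (fun y => eulerOp w y + b * w y) V :=
    fun y hy => by simp only [eulerOp_congr hV h hy, h hy]
  simp only [quadOp, eulerOp_congr hV h1 hx, eulerOp_congr hV h hx, h hx]

theorem SmoothOn₂.contDiffAt_left (h : SmoothOn₂ U V F) (hU : IsOpen U) (ht : t ∈ U) (hx : x ∈ V)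
    (k : ℕ) : ContDiffAt ℝ k (fun s => F s x) t :=
  ((h.contDiffOn_left hx).contDiffAt (hU.mem_nhds ht)).of_le (by exact_mod_cast le_top)

theorem SmoothOn₂.eulerOp_iteratedDeriv (h : SmoothOn₂ U V F) (hU : IsOpen U) (hV : IsOpen V)
    (ht : t ∈ U) (k : ℕ) :
    EqOn (_root_.eulerOp fun y => iteratedDeriv k (fun s => F s y) t)
      (fun y => iteratedDeriv k (fun s => _root_.eulerOp (F s) y) t) V := fun x hx => by
  simp only [_root_.eulerOp]
  rw [h.deriv_iteratedDeriv hU hV ht hx, iteratedDeriv_const_mul_field]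

theorem SmoothOn₂.quadOp_iteratedDeriv (h : SmoothOn₂ U V F) (hU : IsOpen U) (hV : IsOpen V)
    (ht : t ∈ U) (k : ℕ) (a b : ℝ) :
    EqOn (_root_.quadOp a b fun y => iteratedDeriv k (fun s => F s y) t)
      (fun y => iteratedDeriv k (fun s => _root_.quadOp a b (F s) y) t) V := fun x hx => by
  have hE := h.eulerOp_add_mul hU hV b
  have h1 : EqOn (fun y => _root_.eulerOp (fun y => iteratedDeriv k (fun s => F s y) t) y +
        b * iteratedDeriv k (fun s => F s y) t)
      (fun y => iteratedDeriv k (fun s => _root_.eulerOp (F s) y + b * F s y) t) V :=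
    fun y hy => by
      simp only [h.eulerOp_iteratedDeriv hU hV ht k hy]
      rw [iteratedDeriv_fun_add ((h.eulerOp hU hV).contDiffAt_left hU ht hy k)
        ((h.const_mul b).contDiffAt_left hU ht hy k), iteratedDeriv_const_mul_field]
  have h2 := (hE.const_mul a)
  have h3 := (smoothOn₂_right (U := U) (V := V) (f := fun x => x ^ 2) (by fun_prop)).mul h
  have h1x := h1 hx
  simp only at h1x
  simp only [_root_.quadOp]
  rw [eulerOp_congr hV h1 hx, hE.eulerOp_iteratedDeriv hU hV ht k hx, h1x,
    iteratedDeriv_fun_sub (((hE.eulerOp hU hV).add h2).contDiffAt_left hU ht hx k)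
    (h3.contDiffAt_left hU ht hx k),
    iteratedDeriv_fun_add ((hE.eulerOp hU hV).contDiffAt_left hU ht hx k)
    (h2.contDiffAt_left hU ht hx k), iteratedDeriv_const_mul_field, iteratedDeriv_const_mul_field]

theorem iteratedDeriv_id_mul_deriv {f : ℝ → ℝ} (hU : IsOpen U) (hf : ContDiffOn ℝ ∞ f U) (k : ℕ) :
    EqOn (iteratedDeriv k fun s => s * deriv f s)
      (fun s => s * iteratedDeriv (k + 1) f s + k * iteratedDeriv k f s) U := by
  induction k with
  | zero => intro s _; simp
  | succ k ih =>
    intro s hs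
    have hd : ∀ n : ℕ, HasDerivAt (iteratedDeriv n f) (iteratedDeriv (n + 1) f s) s := fun n => by
      rw [iteratedDeriv_succ]
      refine DifferentiableAt.hasDerivAt ?_
      have := (hf.differentiableOn_iteratedDerivWithin (m := n)
        (by exact_mod_cast ENat.natCast_lt_top n) hU.uniqueDiffOn s hs).differentiableAt
        (hU.mem_nhds hs)
      refine this.congr_of_eventuallyEq ?_
      filter_upwards [hU.mem_nhds hs] with y hy using (iteratedDerivWithin_of_isOpen hU hy).symm
    rw [iteratedDeriv_succ, (ih.eventuallyEq_of_mem (hU.mem_nhds hs)).deriv_eq]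
    rw [(((hasDerivAt_id' s).fun_mul (hd (k + 1))).fun_add ((hd k).const_mul (k : ℝ))).deriv]
    push_cast
    ring

end Parametric

theorem quadOp_eq_of_hasDerivAt {a b : ℝ} {v v₁ v₂ : ℝ → ℝ}
    (h₁ : ∀ y ∈ Ioi (0 : ℝ), HasDerivAt v (v₁ y / y) y)
    (h₂ : ∀ y ∈ Ioi (0 : ℝ), HasDerivAt v₁ (v₂ y / y) y) :
    EqOn (quadOp a b v) (fun y => v₂ y + b * v₁ y + a * (v₁ y + b * v y) - y ^ 2 * v y)
      (Ioi 0) := fun x hx => by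
  have e : ∀ (f f₁ : ℝ → ℝ), (∀ y ∈ Ioi (0 : ℝ), HasDerivAt f (f₁ y / y) y) →
      EqOn (eulerOp f) f₁ (Ioi 0) := fun f f₁ h y hy => by
    rw [eulerOp, (h y hy).deriv, mul_div_cancel₀ _ (ne_of_gt hy)]
  have h3 : EqOn (fun y => eulerOp v y + b * v y) (fun y => v₁ y + b * v y) (Ioi 0) :=
    fun y hy => by simp only [e v v₁ h₁ hy]
  have h4 := e (fun y => v₁ y + b * v y) (fun y => v₂ y + b * v₁ y) fun y hy =>
    ((h₂ y hy).fun_add ((h₁ y hy).const_mul b)).congr_deriv (by ring)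
  simp only [quadOp, eulerOp_congr isOpen_Ioi h3 hx, h4 hx, e v v₁ h₁ hx]

/-- The action of `D_{μ,ν}` on a product of solutions of scaled Bessel equations, the scales `a`
and `b` being related by `b = a + 1`. Here `A₁ = θA` and `B₁ = θB`. -/
theorem Dop_mul_eq {μ ν a b w : ℝ} (hab : b = a + 1) {A A₁ B B₁ : ℝ → ℝ}
    (hA : ∀ y ∈ Ioi (0 : ℝ), HasDerivAt A (A₁ y / y) y)
    (hA₁ : ∀ y ∈ Ioi (0 : ℝ), HasDerivAt A₁ ((a ^ 2 * y ^ 2 * A y - μ * A₁ y) / y) y)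
    (hB : ∀ y ∈ Ioi (0 : ℝ), HasDerivAt B (B₁ y / y) y)
    (hB₁ : ∀ y ∈ Ioi (0 : ℝ), HasDerivAt B₁ ((b ^ 2 * y ^ 2 * B y - ν * B₁ y) / y) y)
    {x : ℝ} (hx : 0 < x) :
    Dop μ ν (fun y => w * A y * B y) x = w *
      ((4 * a * b + (ν - μ) * a ^ 2) * (2 * A x * B x + A₁ x * B x + A x * B₁ x)
      + (2 * a * b + 2 * b ^ 2) *
        (2 * A₁ x * B x + (a ^ 2 * x ^ 2 * A x - μ * A₁ x) * B x + A₁ x * B₁ x)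
      + (2 * a * b + 2 * a ^ 2) *
        (2 * A x * B₁ x + A₁ x * B₁ x + A x * (b ^ 2 * x ^ 2 * B x - ν * B₁ x))
      - μ * (ν - μ) * a ^ 2 * A x * B x - (3 * μ + ν) * (a ^ 2 * A x * B₁ x + b ^ 2 * A₁ x * B x)
      + (2 * μ + ν) * ((4 * a * b + (ν - μ) * a ^ 2) * A x * B x
        + (2 * a * b + 2 * b ^ 2) * A₁ x * B x + (2 * a * b + 2 * a ^ 2) * A x * B₁ x)
      + μ * (μ + ν) * (2 * a * b) * A x * B x
      - (2 * a * b * x ^ 2 * A x * B x + (ν - μ) * A₁ x * B x + 2 * A₁ x * B₁ x)) := by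
  have q1 : EqOn (quadOp 0 ν fun y => w * A y * B y)
      (fun y => w * (2 * a * b * (y ^ 2 * A y * B y) + (ν - μ) * (A₁ y * B y)
        + 2 * (A₁ y * B₁ y))) (Ioi 0) := by
    intro y hy
    rw [quadOp_eq_of_hasDerivAt (v₁ := fun y => w * (A₁ y * B y + A y * B₁ y))
      (v₂ := fun y => w * ((a ^ 2 * y ^ 2 * A y - μ * A₁ y) * B y + 2 * (A₁ y * B₁ y)
        + A y * (b ^ 2 * y ^ 2 * B y - ν * B₁ y))) ?_ ?_ hy]
    · simp only [hab]
      ring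
    · exact fun y hy => (((hA y hy).const_mul w).fun_mul (hB y hy)).congr_deriv (by ring)
    · exact fun y hy => ((((hA₁ y hy).fun_mul (hB y hy)).fun_add
        ((hA y hy).fun_mul (hB₁ y hy))).const_mul w).congr_deriv (by ring)
  have hsq : ∀ y ∈ Ioi (0 : ℝ), HasDerivAt (fun y : ℝ => y ^ 2) (2 * y ^ 2 / y) y := fun y hy =>
    (hasDerivAt_pow 2 y).congr_deriv (by
      have : y ≠ 0 := ne_of_gt hy
      field_simp
      norm_num)
  have q2 := quadOp_congr isOpen_Ioi q1 (μ + ν) μ hx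
  have q3 := quadOp_eq_of_hasDerivAt (a := μ + ν) (b := μ)
    (v := fun y => w * (2 * a * b * (y ^ 2 * A y * B y) + (ν - μ) * (A₁ y * B y)
        + 2 * (A₁ y * B₁ y)))
    (v₁ := fun y => w * ((4 * a * b + (ν - μ) * a ^ 2) * (y ^ 2 * A y * B y)
      + (2 * a * b + 2 * b ^ 2) * (y ^ 2 * A₁ y * B y)
      + (2 * a * b + 2 * a ^ 2) * (y ^ 2 * A y * B₁ y)
      - μ * (ν - μ) * (A₁ y * B y) - (3 * μ + ν) * (A₁ y * B₁ y)))
    (v₂ := fun y => w * ((4 * a * b + (ν - μ) * a ^ 2) *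
        (2 * y ^ 2 * A y * B y + y ^ 2 * A₁ y * B y + y ^ 2 * A y * B₁ y)
      + (2 * a * b + 2 * b ^ 2) * (2 * y ^ 2 * A₁ y * B y
        + y ^ 2 * (a ^ 2 * y ^ 2 * A y - μ * A₁ y) * B y + y ^ 2 * A₁ y * B₁ y)
      + (2 * a * b + 2 * a ^ 2) * (2 * y ^ 2 * A y * B₁ y + y ^ 2 * A₁ y * B₁ y
        + y ^ 2 * A y * (b ^ 2 * y ^ 2 * B y - ν * B₁ y))
      - μ * (ν - μ) * ((a ^ 2 * y ^ 2 * A y - μ * A₁ y) * B y + A₁ y * B₁ y)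
      - (3 * μ + ν) * ((a ^ 2 * y ^ 2 * A y - μ * A₁ y) * B₁ y
        + A₁ y * (b ^ 2 * y ^ 2 * B y - ν * B₁ y)))) ?_ ?_ hx
  · rw [Dop, q2, q3]
    have hx0 : x ≠ 0 := hx.ne'
    field_simp
    ring
  · intro y hy
    have h1 := ((hsq y hy).fun_mul (hA y hy)).fun_mul (hB y hy)
    have h2 := (hA₁ y hy).fun_mul (hB y hy)
    have h3 := (hA₁ y hy).fun_mul (hB₁ y hy)
    refine ((((h1.const_mul (2 * a * b)).fun_add (h2.const_mul (ν - μ))).fun_add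
      (h3.const_mul 2)).const_mul w).congr_deriv ?_
    simp only [hab]
    ring
  · intro y hy
    have h1 := ((hsq y hy).fun_mul (hA y hy)).fun_mul (hB y hy)
    have h2 := ((hsq y hy).fun_mul (hA₁ y hy)).fun_mul (hB y hy)
    have h3 := ((hsq y hy).fun_mul (hA y hy)).fun_mul (hB₁ y hy)
    have h4 := (hA₁ y hy).fun_mul (hB y hy)
    have h5 := (hA₁ y hy).fun_mul (hB₁ y hy)
    refine ((((((h1.const_mul (4 * a * b + (ν - μ) * a ^ 2)).fun_add
      (h2.const_mul (2 * a * b + 2 * b ^ 2))).fun_add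
      (h3.const_mul (2 * a * b + 2 * a ^ 2))).fun_sub (h4.const_mul (μ * (ν - μ)))).fun_sub
      (h5.const_mul (3 * μ + ν))).const_mul w).congr_deriv ?_
    ring

theorem IsBesselSolution.hasDerivAt {s : Set ℝ} {β : ℝ} {f : ℝ → ℝ} (h : IsBesselSolution s β f)
    (hs : IsOpen s) {z : ℝ} (hz : z ∈ s) : HasDerivAt f (deriv f z) z :=
  ((h.contDiffOn.contDiffAt (hs.mem_nhds hz)).differentiableAt (by simp)).hasDerivAt

theorem IsBesselSolution.hasDerivAt_mul_deriv {s : Set ℝ} {β : ℝ} {f : ℝ → ℝ}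
    (h : IsBesselSolution s β f) (hs : IsOpen s) {z : ℝ} (hz : z ∈ s) :
    HasDerivAt (fun y => y * deriv f y) (z * f z - β * deriv f z) z := by
  have h1 := ((contDiffOn_infty_iff_deriv_of_isOpen hs).1 h.contDiffOn).2
  have h2 := ((h1.contDiffAt (hs.mem_nhds hz)).differentiableAt (by simp)).hasDerivAt
  refine ((hasDerivAt_id' z).fun_mul h2).congr_deriv ?_
  linear_combination h.ode z hz

/-- For `Q(z) = z^μ·K̃_{μ/2}(z)` this is `t^μ` times the generating function
`(1-t)^{-(μ+ν+2)/2}·K̃_{μ/2}(tx/(1-t))·B(x/(1-t))`. -/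
def scaledGen (μ ν : ℝ) (Q B : ℝ → ℝ) (t x : ℝ) : ℝ :=
  (1 - t) ^ ((μ - ν - 2) / 2) * (x ^ (-μ) * Q (t * x / (1 - t))) * B (x / (1 - t))

section Generating

variable {μ ν : ℝ} {Q B : ℝ → ℝ}

theorem smoothOn₂_scaledGen (hQ : IsBesselSolution univ (-μ) Q)
    (hB : IsBesselSolution (Ioi 0) ν B) : SmoothOn₂ (Iio 1) (Ioi 0) (scaledGen μ ν Q B) := by
  have h1 : ∀ p ∈ Iio (1 : ℝ) ×ˢ Ioi (0 : ℝ), 1 - p.1 ≠ 0 := fun p hp => by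
    have : p.1 < 1 := hp.1
    linarith
  have hQ' := contDiffOn_univ.1 hQ.contDiffOn
  refine ContDiffOn.mul (ContDiffOn.mul ?_ (ContDiffOn.mul ?_ ?_)) ?_
  · exact (contDiffOn_const.sub contDiffOn_fst).rpow_const_of_ne h1
  · exact contDiffOn_snd.rpow_const_of_ne fun p hp => ne_of_gt hp.2
  · exact hQ'.comp_contDiffOn
      ((contDiffOn_fst.mul contDiffOn_snd).div (contDiffOn_const.sub contDiffOn_fst) h1)
  · refine hB.contDiffOn.comp (f := fun p : ℝ × ℝ => p.2 / (1 - p.1))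
      (contDiffOn_snd.div (contDiffOn_const.sub contDiffOn_fst) h1) fun p hp => ?_
    have h2 : p.1 < 1 := hp.1
    have h3 : 0 < p.2 := hp.2
    exact div_pos h3 (sub_pos.2 h2)

/-- The partial differential equation `D_{μ,ν} F = 4(θ_t - μ)(θ_t + 1)F` of `scaledGen`. -/
theorem Dop_scaledGen (hQ : IsBesselSolution univ (-μ) Q) (hB : IsBesselSolution (Ioi 0) ν B)
    {t x : ℝ} (ht : t < 1) (hx : 0 < x) :
    Dop μ ν (scaledGen μ ν Q B t) x =
      4 * (t * deriv (fun s => s * deriv (fun r => scaledGen μ ν Q B r x) s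
          + scaledGen μ ν Q B s x) t
        - μ * (t * deriv (fun r => scaledGen μ ν Q B r x) t + scaledGen μ ν Q B t x)) := by
  have hbpos : ∀ {s : ℝ}, s < 1 → 0 < 1 - s := fun hs => by linarith
  have dQ := fun z => hQ.hasDerivAt isOpen_univ (mem_univ z)
  have dQ₁ := fun z => hQ.hasDerivAt_mul_deriv isOpen_univ (mem_univ z)
  have dB := fun z (hz : z ∈ Ioi (0 : ℝ)) => hB.hasDerivAt isOpen_Ioi hz
  have dB₁ := fun z (hz : z ∈ Ioi (0 : ℝ)) => hB.hasDerivAt_mul_deriv isOpen_Ioi hz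
  set c := (μ - ν - 2) / 2 with hc
  have hD := Dop_mul_eq (μ := μ) (ν := ν) (a := t / (1 - t)) (b := 1 / (1 - t))
    (w := (1 - t) ^ c) (A := fun y => y ^ (-μ) * Q (t * y / (1 - t)))
    (A₁ := fun y => y ^ (-μ) * (t * y / (1 - t) * deriv Q (t * y / (1 - t))
      - μ * Q (t * y / (1 - t))))
    (B := fun y => B (y / (1 - t))) (B₁ := fun y => y / (1 - t) * deriv B (y / (1 - t)))
    (by have := (hbpos ht).ne'
        field_simp
        ring) ?_ ?_ ?_ ?_ hx
  rotate_left
  · intro y hy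
    have hy0 : y ≠ 0 := ne_of_gt hy
    have hz : HasDerivAt (fun y => t * y / (1 - t)) (t / (1 - t)) y :=
      (((hasDerivAt_id' y).const_mul t).div_const _).congr_deriv (by ring)
    refine ((Real.hasDerivAt_rpow_const (p := -μ) (Or.inl hy0)).fun_mul
      ((dQ _).comp y hz)).congr_deriv ?_
    rw [Real.rpow_sub_one hy0]
    simp only [Function.comp]
    field_simp
    ring
  · intro y hy
    have hy0 : y ≠ 0 := ne_of_gt hy
    have hz : HasDerivAt (fun y => t * y / (1 - t)) (t / (1 - t)) y :=
      (((hasDerivAt_id' y).const_mul t).div_const _).congr_deriv (by ring)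
    refine ((Real.hasDerivAt_rpow_const (p := -μ) (Or.inl hy0)).fun_mul
      ((((dQ₁ _).fun_sub ((dQ _).const_mul μ))).comp y hz)).congr_deriv ?_
    have := (hbpos ht).ne'
    rw [Real.rpow_sub_one hy0]
    simp only [Function.comp]
    field_simp
    ring
  · intro y hy
    have hy0 : y ≠ 0 := ne_of_gt hy
    have hz : HasDerivAt (fun y => y / (1 - t)) (1 / (1 - t)) y := (hasDerivAt_id' y).div_const _
    refine ((dB _ (div_pos hy (hbpos ht))).comp y hz).congr_deriv ?_
    field_simp
  · intro y hy
    have hy0 : y ≠ 0 := ne_of_gt hy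
    have hz : HasDerivAt (fun y => y / (1 - t)) (1 / (1 - t)) y := (hasDerivAt_id' y).div_const _
    refine ((dB₁ _ (div_pos hy (hbpos ht))).comp y hz).congr_deriv ?_
    have := (hbpos ht).ne'
    field_simp
  set X := x ^ (-μ)
  let w : ℝ → ℝ := fun s => (1 - s) ^ c
  let a : ℝ → ℝ := fun s => s / (1 - s)
  let b : ℝ → ℝ := fun s => 1 / (1 - s)
  let A : ℝ → ℝ := fun s => X * Q (s * x / (1 - s))
  let P : ℝ → ℝ := fun s => X * x * deriv Q (s * x / (1 - s))
  let A₁ : ℝ → ℝ := fun s =>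
    X * (s * x / (1 - s) * deriv Q (s * x / (1 - s)) - μ * Q (s * x / (1 - s)))
  let C : ℝ → ℝ := fun s => B (x / (1 - s))
  let C₁ : ℝ → ℝ := fun s => x / (1 - s) * deriv B (x / (1 - s))
  have hb : ∀ s ∈ Iio (1 : ℝ), b s = a s + 1 := fun s hs => by
    have := (hbpos hs).ne'
    simp only [a, b]
    field_simp
    ring
  have hab : ∀ s, s * b s = a s := fun s => by simp only [a, b]; ring
  have hA₁ : ∀ s, A₁ s = a s * P s - μ * A s := fun s => by simp only [a, A, A₁, P]; ring
  have hsub : ∀ s, HasDerivAt (fun s : ℝ => 1 - s) (-1) s := fun s =>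
    (hasDerivAt_id' s).const_sub 1
  have dz : ∀ s ∈ Iio (1 : ℝ), HasDerivAt (fun s => s * x / (1 - s)) (x * b s ^ 2) s :=
    fun s hs => by
      have := (hbpos hs).ne'
      refine (((hasDerivAt_id' s).mul_const x).fun_div (hsub s) this).congr_deriv ?_
      simp only [b]
      field_simp
      ring
  have dy : ∀ s ∈ Iio (1 : ℝ), HasDerivAt (fun s => x / (1 - s)) (x * b s ^ 2) s :=
    fun s hs => by
      have := (hbpos hs).ne'
      refine ((hasDerivAt_const s x).fun_div (hsub s) this).congr_deriv ?_
      simp only [b]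
      field_simp
      ring
  have dw : ∀ s ∈ Iio (1 : ℝ), HasDerivAt w (-c * b s * w s) s := fun s hs => by
    have := (hbpos hs).ne'
    refine ((hsub s).rpow_const (p := c) (Or.inl this)).congr_deriv ?_
    rw [Real.rpow_sub_one this]
    simp only [b, w]
    ring
  have da : ∀ s ∈ Iio (1 : ℝ), HasDerivAt a (b s ^ 2) s := fun s hs => by
    have := (hbpos hs).ne'
    refine ((hasDerivAt_id' s).fun_div (hsub s) this).congr_deriv ?_
    simp only [b]
    field_simp
    ring
  have db : ∀ s ∈ Iio (1 : ℝ), HasDerivAt b (b s ^ 2) s := fun s hs => by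
    have := (hbpos hs).ne'
    refine ((hasDerivAt_const s (1 : ℝ)).fun_div (hsub s) this).congr_deriv ?_
    simp only [b]
    field_simp
    ring
  have dA : ∀ s ∈ Iio (1 : ℝ), HasDerivAt A (b s ^ 2 * P s) s := fun s hs =>
    (((dQ _).comp s (dz s hs)).const_mul X).congr_deriv (by simp only [P]; ring)
  have dA₁ : ∀ s ∈ Iio (1 : ℝ), HasDerivAt A₁ (a s * b s ^ 2 * x ^ 2 * A s) s := fun s hs =>
    ((((dQ₁ _).fun_sub ((dQ _).const_mul μ)).comp s (dz s hs)).const_mul X).congr_deriv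
      (by simp only [a, A]; ring)
  have hypos : ∀ s ∈ Iio (1 : ℝ), x / (1 - s) ∈ Ioi (0 : ℝ) := fun s hs => div_pos hx (hbpos hs)
  have dC : ∀ s ∈ Iio (1 : ℝ), HasDerivAt C (b s * C₁ s) s := fun s hs =>
    ((dB _ (hypos s hs)).comp s (dy s hs)).congr_deriv (by simp only [b, C₁]; ring)
  have dC₁ : ∀ s ∈ Iio (1 : ℝ),
      HasDerivAt C₁ (b s * (b s ^ 2 * x ^ 2 * C s - ν * C₁ s)) s := fun s hs =>
    (HasDerivAt.comp (h₂ := fun y => y * deriv B y) s (dB₁ _ (hypos s hs)) (dy s hs)).congr_deriv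
      (by simp only [b, C, C₁]; ring)
  let N : ℝ → ℝ := fun s => (1 - c * a s + b s * μ) * (A s * C s) + b s * (A₁ s * C s)
    + a s * (A s * C₁ s)
  have hH : ∀ s ∈ Iio (1 : ℝ), s * deriv (fun r => scaledGen μ ν Q B r x) s
      + scaledGen μ ν Q B s x = w s * N s := fun s hs => by
    rw [show (fun r => scaledGen μ ν Q B r x) = fun r => w r * A r * C r from rfl,
      (((dw s hs).fun_mul (dA s hs)).fun_mul (dC s hs)).deriv,
      show scaledGen μ ν Q B s x = w s * A s * C s from rfl]
    simp only [N]
    rw [hA₁]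
    linear_combination (w s * (-c * A s * C s + b s * P s * C s + A s * C₁ s)) * hab s
  let K : ℝ := -c * N t + ((μ - c) * b t * A t * C t
    + (1 - c * a t + b t * μ) * (b t * P t * C t + A t * C₁ t) + b t * A₁ t * C t
    + b t * (a t * b t * x ^ 2 * A t * C t + A₁ t * C₁ t) + b t * A t * C₁ t
    + a t * (b t * P t * C₁ t + A t * (b t ^ 2 * x ^ 2 * C t - ν * C₁ t)))
  have dN : HasDerivAt (fun s => w s * N s) (w t * (b t * K)) t := by
    have hAC := (dA t ht).fun_mul (dC t ht)
    have h1 := ((((da t ht).const_mul c).const_sub 1).fun_add ((db t ht).mul_const μ)).fun_mul hAC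
    have h2 := (db t ht).fun_mul ((dA₁ t ht).fun_mul (dC t ht))
    have h3 := (da t ht).fun_mul ((dA t ht).fun_mul (dC₁ t ht))
    refine ((dw t ht).fun_mul ((h1.fun_add h2).fun_add h3)).congr_deriv ?_
    simp only [K, N]
    ring
  have hHt : (fun s => s * deriv (fun r => scaledGen μ ν Q B r x) s
      + scaledGen μ ν Q B s x) =ᶠ[𝓝 t] fun s => w s * N s := by
    filter_upwards [Iio_mem_nhds ht] with s hs using hH s hs
  rw [hHt.deriv_eq, dN.deriv, hH t ht]
  have hfin : 4 * (t * (w t * (b t * K)) - μ * (w t * N t)) = 4 * w t * (a t * K - μ * N t) := by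
    linear_combination 4 * w t * K * hab t
  rw [hfin]
  refine hD.trans ?_
  change w t * ((4 * a t * b t + (ν - μ) * a t ^ 2) * (2 * A t * C t + A₁ t * C t + A t * C₁ t)
      + (2 * a t * b t + 2 * b t ^ 2) *
        (2 * A₁ t * C t + (a t ^ 2 * x ^ 2 * A t - μ * A₁ t) * C t + A₁ t * C₁ t)
      + (2 * a t * b t + 2 * a t ^ 2) *
        (2 * A t * C₁ t + A₁ t * C₁ t + A t * (b t ^ 2 * x ^ 2 * C t - ν * C₁ t))
      - μ * (ν - μ) * a t ^ 2 * A t * C t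
      - (3 * μ + ν) * (a t ^ 2 * A t * C₁ t + b t ^ 2 * A₁ t * C t)
      + (2 * μ + ν) * ((4 * a t * b t + (ν - μ) * a t ^ 2) * A t * C t
        + (2 * a t * b t + 2 * b t ^ 2) * A₁ t * C t + (2 * a t * b t + 2 * a t ^ 2) * A t * C₁ t)
      + μ * (μ + ν) * (2 * a t * b t) * A t * C t
      - (2 * a t * b t * x ^ 2 * A t * C t + (ν - μ) * A₁ t * C t + 2 * A₁ t * C₁ t)) = _
  simp only [K, N, hA₁ t, hb t ht, hc]
  ring

theorem Dop_iteratedDeriv_scaledGen (hQ : IsBesselSolution univ (-μ) Q)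
    (hB : IsBesselSolution (Ioi 0) ν B) (k : ℕ) {x : ℝ} (hx : 0 < x) :
    Dop μ ν (fun y => iteratedDeriv k (fun s => scaledGen μ ν Q B s y) 0) x =
      4 * (k - μ) * (k + 1) * iteratedDeriv k (fun s => scaledGen μ ν Q B s x) 0 := by
  have hF := smoothOn₂_scaledGen hQ hB
  have hU : IsOpen (Iio (1 : ℝ)) := isOpen_Iio
  have h0 : (0 : ℝ) ∈ Iio (1 : ℝ) := mem_Iio.2 one_pos
  have hx' : x ∈ Ioi (0 : ℝ) := hx
  have hT : SmoothOn₂ (Iio 1) (Ioi 0) fun t y =>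
      t * deriv (fun s => scaledGen μ ν Q B s y) t :=
    (smoothOn₂_left contDiff_id).mul (hF.deriv_left hU isOpen_Ioi)
  have hH := hT.add hF
  have hTH : SmoothOn₂ (Iio 1) (Ioi 0) fun t y => t * deriv (fun s =>
      s * deriv (fun r => scaledGen μ ν Q B r y) s + scaledGen μ ν Q B s y) t :=
    (smoothOn₂_left contDiff_id).mul (hH.deriv_left hU isOpen_Ioi)
  have hpde : (fun s => quadOp (μ + ν) μ (quadOp 0 ν (scaledGen μ ν Q B s)) x) =ᶠ[𝓝 0]
      fun s => (4 * x ^ 2) * (s * deriv (fun s =>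
        s * deriv (fun r => scaledGen μ ν Q B r x) s + scaledGen μ ν Q B s x) s
        - μ * (s * deriv (fun r => scaledGen μ ν Q B r x) s + scaledGen μ ν Q B s x)) := by
    filter_upwards [hU.mem_nhds h0] with s hs
    have h := Dop_scaledGen hQ hB hs hx
    rw [Dop, div_eq_iff (by positivity)] at h
    rw [h]
    ring
  have hHk : iteratedDeriv k (fun s => s * deriv (fun r => scaledGen μ ν Q B r x) s +
      scaledGen μ ν Q B s x) 0 = (k + 1) * iteratedDeriv k (fun s => scaledGen μ ν Q B s x) 0 := by
    rw [iteratedDeriv_fun_add (hT.contDiffAt_left hU h0 hx' k) (hF.contDiffAt_left hU h0 hx' k),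
      iteratedDeriv_id_mul_deriv hU (hF.contDiffOn_left hx') k h0]
    ring
  rw [Dop, quadOp_congr isOpen_Ioi (hF.quadOp_iteratedDeriv hU isOpen_Ioi h0 k 0 ν) _ _ hx',
    (hF.quadOp hU isOpen_Ioi 0 ν).quadOp_iteratedDeriv hU isOpen_Ioi h0 k _ _ hx']
  beta_reduce
  rw [hpde.iteratedDeriv_eq, iteratedDeriv_const_mul_field,
    iteratedDeriv_fun_sub (hTH.contDiffAt_left hU h0 hx' k)
      ((hH.const_mul μ).contDiffAt_left hU h0 hx' k),
    iteratedDeriv_const_mul_field,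
    iteratedDeriv_id_mul_deriv hU (hH.contDiffOn_left hx') k h0]
  beta_reduce
  rw [hHk]
  field_simp
  ring

theorem limUnder_iteratedDeriv_eq {F f : ℝ → ℝ} {U : Set ℝ} (hU : IsOpen U) (h0 : (0 : ℝ) ∈ U)
    (hF : ContDiffOn ℝ ∞ F U) (hf : f =ᶠ[𝓝[>] 0] F) (k : ℕ) :
    limUnder (𝓝[>] (0 : ℝ)) (iteratedDeriv k f) = iteratedDeriv k F 0 := by
  have hc : ContinuousAt (iteratedDeriv k F) 0 := by
    refine ((hF.continuousOn_iteratedDerivWithin (m := k) (by exact_mod_cast le_top)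
      hU.uniqueDiffOn).continuousAt (hU.mem_nhds h0)).congr ?_
    filter_upwards [hU.mem_nhds h0] with y hy using iteratedDerivWithin_of_isOpen hU hy
  refine Tendsto.limUnder_eq ((hc.tendsto.mono_left nhdsWithin_le_nhds).congr' ?_)
  filter_upwards [eventually_eventually_nhdsWithin.2 hf, self_mem_nhdsWithin] with s hs hpos
  rw [nhdsWithin_eq_nhds.2 (Ioi_mem_nhds hpos)] at hs
  exact (Filter.EventuallyEq.iteratedDeriv_eq k hs).symm

theorem eulerOp_const_mul (c : ℝ) (v : ℝ → ℝ) :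
    eulerOp (fun y => c * v y) = fun y => c * eulerOp v y := funext fun x => by
  simp only [eulerOp, deriv_const_mul_field]
  ring

theorem quadOp_const_mul (a b c : ℝ) (v : ℝ → ℝ) :
    quadOp a b (fun y => c * v y) = fun y => c * quadOp a b v y := funext fun x => by
  have h : (fun y => c * eulerOp v y + b * (c * v y)) = fun y => c * (eulerOp v y + b * v y) :=
    funext fun y => by ring
  simp only [quadOp, eulerOp_const_mul, h]
  ring

theorem Dop_const_mul (μ ν c : ℝ) (v : ℝ → ℝ) (x : ℝ) :
    Dop μ ν (fun y => c * v y) x = c * Dop μ ν v x := by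
  simp only [Dop, quadOp_const_mul, mul_div_assoc]

theorem pow_mul_gen_eq_scaledGen {m : ℕ}
    (hK : ∀ z : ℝ, 0 < z → z ^ m * tildeK ((m : ℝ) / 2) z = Q z) {s y : ℝ} (hs0 : 0 < s)
    (hs1 : s < 1) (hy : 0 < y) :
    s ^ m * ((1 - s) ^ (-((m : ℝ) + ν + 2) / 2) * tildeK ((m : ℝ) / 2) (s * y / (1 - s)) *
      B (y / (1 - s))) = scaledGen m ν Q B s y := by
  have h1 : 0 < 1 - s := by linarith
  have hz : 0 < s * y / (1 - s) := by positivity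
  rw [scaledGen, ← hK _ hz, show ((m : ℝ) - ν - 2) / 2 = -((m : ℝ) + ν + 2) / 2 + m by ring,
    Real.rpow_add h1, Real.rpow_natCast, Real.rpow_neg hy.le, Real.rpow_natCast, div_pow, mul_pow]
  field_simp

theorem Dop_limUnder_iteratedDeriv {m : ℕ} (hQ : IsBesselSolution univ (-(m : ℝ)) Q)
    (hK : ∀ z : ℝ, 0 < z → z ^ m * tildeK ((m : ℝ) / 2) z = Q z)
    (hB : IsBesselSolution (Ioi 0) ν B) (k : ℕ) (L : ℝ → ℝ)
    (hL : ∀ y, L y = limUnder (𝓝[>] (0 : ℝ)) (iteratedDeriv k fun s => s ^ m *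
      ((1 - s) ^ (-((m : ℝ) + ν + 2) / 2) * tildeK ((m : ℝ) / 2) (s * y / (1 - s)) *
        B (y / (1 - s)))) / k.factorial) {x : ℝ} (hx : 0 < x) :
    Dop m ν L x = 4 * (k - m) * (k + 1) * L x := by
  have hL' : EqOn L (fun y => (k.factorial : ℝ)⁻¹ *
      iteratedDeriv k (fun s => scaledGen m ν Q B s y) 0) (Ioi 0) := fun y hy => by
    rw [hL y, limUnder_iteratedDeriv_eq isOpen_Iio (mem_Iio.2 one_pos)
      ((smoothOn₂_scaledGen hQ hB).contDiffOn_left hy) ?_ k, div_eq_inv_mul]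
    filter_upwards [Ioo_mem_nhdsGT (one_pos : (0 : ℝ) < 1)] with s hs
      using pow_mul_gen_eq_scaledGen hK hs.1 hs.2 hy
  have h1 : Dop m ν L x = Dop m ν (fun y => (k.factorial : ℝ)⁻¹ *
      iteratedDeriv k (fun s => scaledGen m ν Q B s y) 0) x := by
    rw [Dop, Dop, quadOp_congr isOpen_Ioi (quadOp_congr isOpen_Ioi hL' 0 ν) _ _ hx]
  rw [h1, Dop_const_mul, Dop_iteratedDeriv_scaledGen hQ hB k hx, hL' hx]
  ring

end Generating

/-- For `μ` a positive odd integer, `ν ∈ ℝ`, `i ∈ {3,4}` and integer `j ≥ −μ`, the function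
`Λ_{i,j}^{μ,ν}` satisfies `D_{μ,ν} Λ_{i,j}^{μ,ν} = 4j(j+μ+1)·Λ_{i,j}^{μ,ν}` on `(0,∞)`. -/
theorem statement5 (m : ℕ) (hm : Odd m) (hm0 : 0 < m) (ν : ℝ) (j : ℤ)
    (hj : -(m : ℤ) ≤ j) (x : ℝ) (hx : 0 < x) :
    Dop (m : ℝ) ν (fun y => Lambda₃ m ν j y) x
      = 4 * (j : ℝ) * ((j : ℝ) + (m : ℝ) + 1) * Lambda₃ m ν j x ∧
    Dop (m : ℝ) ν (fun y => Lambda₄ m ν j y) x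
      = 4 * (j : ℝ) * ((j : ℝ) + (m : ℝ) + 1) * Lambda₄ m ν j x := by
  obtain ⟨n, rfl⟩ := hm
  obtain ⟨Q, hQ, hK⟩ := exists_isBesselSolution_pow_mul_tildeK n
  set m := 2 * n + 1
  obtain ⟨k, hk⟩ := Int.eq_ofNat_of_zero_le (show 0 ≤ j + (m : ℤ) by linarith)
  have hjk : (k : ℝ) = j + m := by exact_mod_cast hk.symm
  have h := fun (B : ℝ → ℝ) (hB : IsBesselSolution (Ioi 0) ν B) =>
    Dop_limUnder_iteratedDeriv hQ hK hB k
  have e : 4 * (j : ℝ) * ((j : ℝ) + (m : ℝ) + 1) = 4 * (k - m) * (k + 1) := by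
    rw [hjk]
    ring
  rw [e]
  refine ⟨h _ (isBesselSolution_tildeI ν (Ioi 0)) _ (fun y => ?_) hx,
    h _ (isBesselSolution_tildeK ν) _ (fun y => ?_) hx⟩
  · rw [Lambda₃, if_pos hj, hk, Int.toNat_natCast]
    rfl
  · rw [Lambda₄, if_pos hj, hk, Int.toNat_natCast]
    rfl
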